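/- Let U \subseteq \mathbb{R} be an open interval, F : U \to \mathbb{R} continuous, and G(x,t) = (\partial S/\partial x)(x,t) + F(x) \cdot S(x,t). Suppose G(x,t) \ge 0 for all (x,t) \in U \times [0,1] (resp. G \le 0) and there is a nonempty open set E \subseteq [0,1] such that G(x,t) \ne 0 for all (x,t) \in U \times E. Then equation (1) has at most one periodic solution taking values in U, and every periodic solution x with values in U is hyperbolic unstable (resp. stable), i.e., \int_0^1 (\partial S/\partial x)(x(t),t)\,dt > 0 (resp. < 0). -/

import Mathlib

open Set

/-- `x` is a periodic solution of `dx/dt = S(x,t)` on `[0,1]`. -/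
def IsPeriodicSol (S : ℝ → ℝ → ℝ) (x : ℝ → ℝ) : Prop :=
  (∀ t ∈ Set.Icc (0:ℝ) 1, HasDerivWithinAt x (S (x t) t) (Set.Icc (0:ℝ) 1) t) ∧ x 0 = x 1

theorem exists_antideriv_of_ordConnected {U : Set ℝ} (hU : IsOpen U) (hUc : U.OrdConnected)
    {F : ℝ → ℝ} (hF : ContinuousOn F U) :
    ∃ Φ : ℝ → ℝ, ∀ x ∈ U, HasDerivAt Φ (F x) x := by
  rcases U.eq_empty_or_nonempty with rfl | ⟨c, hc⟩
  · exact ⟨0, by simp⟩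
  · refine ⟨fun x => ∫ y in c..x, F y, fun x hx => ?_⟩
    exact intervalIntegral.integral_hasDerivAt_right
      (hF.mono (hUc.uIcc_subset hc hx)).intervalIntegrable
      (hF.stronglyMeasurableAtFilter hU x hx) (hF.continuousAt (hU.mem_nhds hx))

theorem integral_eq_zero_of_hasDerivWithinAt_of_eq {f g : ℝ → ℝ} {a b : ℝ} (hab : a ≤ b)
    (hf : ContinuousOn f (Icc a b))
    (hg : ∀ t ∈ Icc a b, HasDerivWithinAt g (f t) (Icc a b) t) (hper : g a = g b) :
    ∫ t in a..b, f t = 0 := by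
  rw [intervalIntegral.integral_eq_sub_of_hasDerivAt_of_le hab
    (fun t ht => (hg t ht).continuousWithinAt)
    (fun t ht => (hg t (Ioo_subset_Icc_self ht)).hasDerivAt (Icc_mem_nhds ht.1 ht.2))
    (hf.intervalIntegrable_of_Icc hab), hper, sub_self]

theorem IsPeriodicSol.continuousOn {S : ℝ → ℝ → ℝ} {x : ℝ → ℝ} (hx : IsPeriodicSol S x) :
    ContinuousOn x (Icc 0 1) :=
  fun t ht => (hx.1 t ht).continuousWithinAt

/-- If `σ (S_x + F S) ≥ 0` along a periodic solution, with strict inequality at some time, then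
`σ ∫ S_x > 0` along that solution, because `∫ F(x) x' = 0`. -/
theorem IsPeriodicSol.integral_pos {S S' : ℝ → ℝ → ℝ} {x : ℝ → ℝ} (hx : IsPeriodicSol S x)
    {U : Set ℝ} (hU : IsOpen U) (hUc : U.OrdConnected) {F : ℝ → ℝ} (hF : ContinuousOn F U)
    (hxU : ∀ t ∈ Icc (0:ℝ) 1, x t ∈ U)
    (hS : ContinuousOn (fun t => S (x t) t) (Icc 0 1))
    (hS' : ContinuousOn (fun t => S' (x t) t) (Icc 0 1)) {σ : ℝ}
    (hsign : ∀ t ∈ Icc (0:ℝ) 1, 0 ≤ σ * (S' (x t) t + F (x t) * S (x t) t))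
    (hpos : ∃ t ∈ Icc (0:ℝ) 1, 0 < σ * (S' (x t) t + F (x t) * S (x t) t)) :
    0 < σ * ∫ t in (0:ℝ)..1, S' (x t) t := by
  obtain ⟨Φ, hΦ⟩ := exists_antideriv_of_ordConnected hU hUc hF
  have hFS : ContinuousOn (fun t => F (x t) * S (x t) t) (Icc 0 1) :=
    (hF.comp hx.continuousOn hxU).mul hS
  have hzero : ∫ t in (0:ℝ)..1, F (x t) * S (x t) t = 0 :=
    integral_eq_zero_of_hasDerivWithinAt_of_eq (g := fun t => Φ (x t)) zero_le_one hFS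
      (fun t ht => (hΦ _ (hxU t ht)).comp_hasDerivWithinAt t (hx.1 t ht)) (by simp only [hx.2])
  have key : 0 < ∫ t in (0:ℝ)..1, σ * (S' (x t) t + F (x t) * S (x t) t) :=
    intervalIntegral.integral_pos zero_lt_one (continuousOn_const.mul (hS'.add hFS))
      (fun t ht => hsign t (Ioc_subset_Icc_self ht)) hpos
  rwa [intervalIntegral.integral_const_mul, intervalIntegral.integral_add
    (hS'.intervalIntegrable_of_Icc zero_le_one) (hFS.intervalIntegrable_of_Icc zero_le_one),
    hzero, add_zero] at key

theorem mul_sub_mul_sub_nonneg_of_monotoneOn {f g : ℝ → ℝ} {U : Set ℝ} (hf : MonotoneOn f U)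
    (hg : MonotoneOn g U) {p q : ℝ} (hp : p ∈ U) (hq : q ∈ U) :
    0 ≤ (f p - f q) * (g p - g q) := by
  rcases le_total p q with h | h
  · exact mul_nonneg_of_nonpos_of_nonpos (sub_nonpos.2 (hf hp hq h)) (sub_nonpos.2 (hg hp hq h))
  · exact mul_nonneg (sub_nonneg.2 (hf hq hp h)) (sub_nonneg.2 (hg hq hp h))

theorem mul_sub_mul_sub_pos_of_strictMonoOn {f g : ℝ → ℝ} {U : Set ℝ} (hf : StrictMonoOn f U)
    (hg : StrictMonoOn g U) {p q : ℝ} (hp : p ∈ U) (hq : q ∈ U) (hpq : p ≠ q) :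
    0 < (f p - f q) * (g p - g q) := by
  rcases hpq.lt_or_gt with h | h
  · exact mul_pos_of_neg_of_neg (sub_neg.2 (hf hp hq h)) (sub_neg.2 (hg hp hq h))
  · exact mul_pos (sub_pos.2 (hf hq hp h)) (sub_pos.2 (hg hq hp h))

/-- Let `μ = exp ∫ F` and `ψ = ∫ μ`. Since `σ μ S` is monotone in the space variable, the squared
distance `(ψ(x) - ψ(y))²` of two periodic solutions is monotone in time, hence constant; this
constant is zero because `σ μ S` is strictly monotone at the time `t₀`. -/
theorem IsPeriodicSol.eqOn {S S' : ℝ → ℝ → ℝ} {x y : ℝ → ℝ}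
    (hx : IsPeriodicSol S x) (hy : IsPeriodicSol S y)
    {U : Set ℝ} (hU : IsOpen U) (hUc : U.OrdConnected) {F : ℝ → ℝ} (hF : ContinuousOn F U)
    (hxU : ∀ t ∈ Icc (0:ℝ) 1, x t ∈ U) (hyU : ∀ t ∈ Icc (0:ℝ) 1, y t ∈ U)
    (hSx : ContinuousOn (fun t => S (x t) t) (Icc 0 1))
    (hSy : ContinuousOn (fun t => S (y t) t) (Icc 0 1))
    (hS' : ∀ t, ∀ p ∈ U, HasDerivAt (fun z => S z t) (S' p t) p) {σ : ℝ}
    (hsign : ∀ p ∈ U, ∀ t ∈ Icc (0:ℝ) 1, 0 ≤ σ * (S' p t + F p * S p t))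
    {t₀ : ℝ} (ht₀ : t₀ ∈ Icc (0:ℝ) 1) (hpos : ∀ p ∈ U, 0 < σ * (S' p t₀ + F p * S p t₀)) :
    EqOn x y (Icc 0 1) := by
  obtain ⟨Φ, hΦ⟩ := exists_antideriv_of_ordConnected hU hUc hF
  have hμ : ∀ p ∈ U, HasDerivAt (fun z => Real.exp (Φ z)) (Real.exp (Φ p) * F p) p :=
    fun p hp => (hΦ p hp).exp
  have hμc : ContinuousOn (fun z => Real.exp (Φ z)) U :=
    fun p hp => (hμ p hp).continuousAt.continuousWithinAt
  obtain ⟨ψ, hψ⟩ := exists_antideriv_of_ordConnected hU hUc hμc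
  have hψmono : StrictMonoOn ψ U := by
    refine strictMonoOn_of_deriv_pos hUc.convex
      (fun p hp => (hψ p hp).continuousAt.continuousWithinAt) fun p hp => ?_
    rw [(hψ p (interior_subset hp)).deriv]
    exact Real.exp_pos _
  set V : ℝ → ℝ → ℝ := fun t z => σ * (Real.exp (Φ z) * S z t) with hV
  have hVd : ∀ t, ∀ p ∈ U,
      HasDerivAt (V t) (Real.exp (Φ p) * (σ * (S' p t + F p * S p t))) p := by
    intro t p hp
    refine (((hμ p hp).mul (hS' t p hp)).const_mul σ).congr_deriv ?_
    ring
  have hVc : ∀ t, ContinuousOn (V t) U :=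
    fun t p hp => (hVd t p hp).continuousAt.continuousWithinAt
  have hVmono : ∀ t ∈ Icc (0:ℝ) 1, MonotoneOn (V t) U := by
    intro t ht
    refine monotoneOn_of_deriv_nonneg hUc.convex (hVc t)
      (fun p hp => (hVd t p (interior_subset hp)).differentiableAt.differentiableWithinAt)
      fun p hp => ?_
    rw [(hVd t p (interior_subset hp)).deriv]
    exact mul_nonneg (Real.exp_pos _).le (hsign p (interior_subset hp) t ht)
  have hVstrict : StrictMonoOn (V t₀) U := by
    refine strictMonoOn_of_deriv_pos hUc.convex (hVc t₀) fun p hp => ?_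
    rw [(hVd t₀ p (interior_subset hp)).deriv]
    exact mul_pos (Real.exp_pos _) (hpos p (interior_subset hp))
  have hψd : ∀ {z : ℝ → ℝ}, IsPeriodicSol S z → (∀ t ∈ Icc (0:ℝ) 1, z t ∈ U) → ∀ t ∈ Icc (0:ℝ) 1,
      HasDerivWithinAt (fun t => ψ (z t)) (Real.exp (Φ (z t)) * S (z t) t) (Icc 0 1) t :=
    fun hz hzU t ht => (hψ _ (hzU t ht)).comp_hasDerivWithinAt t (hz.1 t ht)
  have hDd : ∀ t ∈ Icc (0:ℝ) 1, HasDerivWithinAt (fun t => σ / 2 * (ψ (x t) - ψ (y t)) ^ 2)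
      ((ψ (x t) - ψ (y t)) * (V t (x t) - V t (y t))) (Icc 0 1) t := by
    intro t ht
    refine ((((hψd hx hxU t ht).sub (hψd hy hyU t ht)).pow 2).const_mul (σ / 2)).congr_deriv ?_
    simp only [hV, Pi.sub_apply]
    norm_num
    ring
  have hψc : ContinuousOn (fun t => ψ (x t) - ψ (y t)) (Icc 0 1) := fun t ht =>
    ((hψd hx hxU t ht).sub (hψd hy hyU t ht)).continuousWithinAt
  have hDc : ContinuousOn (fun t => (ψ (x t) - ψ (y t)) * (V t (x t) - V t (y t))) (Icc 0 1) :=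
    hψc.mul ((continuousOn_const.mul ((hμc.comp hx.continuousOn hxU).mul hSx)).sub
      (continuousOn_const.mul ((hμc.comp hy.continuousOn hyU).mul hSy)))
  have hzero := integral_eq_zero_of_hasDerivWithinAt_of_eq zero_le_one hDc hDd
    (by simp only [hx.2, hy.2])
  have hnonneg : ∀ t ∈ Icc (0:ℝ) 1, 0 ≤ (ψ (x t) - ψ (y t)) * (V t (x t) - V t (y t)) :=
    fun t ht => mul_sub_mul_sub_nonneg_of_monotoneOn hψmono.monotoneOn (hVmono t ht)
      (hxU t ht) (hyU t ht)
  have hvanish : ∀ t ∈ Icc (0:ℝ) 1, (ψ (x t) - ψ (y t)) * (V t (x t) - V t (y t)) = 0 := by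
    intro t ht
    by_contra hne
    exact (intervalIntegral.integral_pos zero_lt_one hDc
      (fun s hs => hnonneg s (Ioc_subset_Icc_self hs))
      ⟨t, ht, (hnonneg t ht).lt_of_ne' hne⟩).ne' hzero
  have heq₀ : x t₀ = y t₀ := by
    by_contra hne
    exact (mul_sub_mul_sub_pos_of_strictMonoOn hψmono hVstrict (hxU t₀ ht₀) (hyU t₀ ht₀) hne).ne'
      (hvanish t₀ ht₀)
  have hσ : σ ≠ 0 := by
    rintro rfl
    simpa using hpos _ (hxU t₀ ht₀)
  intro t ht
  have hconst := (convex_Icc (0:ℝ) 1).is_const_of_fderivWithin_eq_zero (𝕜 := ℝ)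
    (fun t ht => (hDd t ht).differentiableWithinAt) (fun t ht => by
      have h := hDd t ht
      rw [hvanish t ht] at h
      simpa using h.hasFDerivWithinAt.fderivWithin (uniqueDiffOn_Icc_zero_one t ht)) ht ht₀
  have hψeq : ψ (x t) = ψ (y t) := by
    simpa [heq₀, hσ, sub_eq_zero] using hconst
  exact hψmono.injOn (hxU t ht) (hyU t ht) hψeq

/-- Lemma 2.1 (ii): if `σ·G ≥ 0` on `U × [0,1]` (`σ = 1` resp. `σ = -1`) and `G ≠ 0` on
`U × E` for a nonempty open `E ⊆ [0,1]`, then there is at most one periodic solution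
with values in `U`, and it is hyperbolic unstable (resp. stable). -/
theorem abel_at_most_one_in_U (m : ℕ) (hm : 1 ≤ m) (a : ℕ → ℝ → ℝ)
    (ha : ∀ i ≤ m, ContDiffOn ℝ (⊤ : ℕ∞) (a i) (Set.Icc (0:ℝ) 1))
    (S : ℝ → ℝ → ℝ)
    (hS : ∀ x t, S x t = ∑ i ∈ Finset.range (m + 1), a i t * x ^ i)
    (U : Set ℝ) (hUopen : IsOpen U) (hUconn : U.OrdConnected)
    (F : ℝ → ℝ) (hF : ContinuousOn F U)
    (G : ℝ → ℝ → ℝ)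
    (hG : ∀ x t, G x t = deriv (fun y => S y t) x + F x * S x t)
    (E : Set ℝ) (hEne : E.Nonempty) (hEsub : E ⊆ Set.Icc (0:ℝ) 1)
    (hEopen : IsOpen {t : Set.Icc (0:ℝ) 1 | (t : ℝ) ∈ E})
    (σ : ℝ) (hσ : σ = 1 ∨ σ = -1)
    (hGsign : ∀ x ∈ U, ∀ t ∈ Set.Icc (0:ℝ) 1, 0 ≤ σ * G x t)
    (hGne : ∀ x ∈ U, ∀ t ∈ E, G x t ≠ 0) :
    (∀ x y : ℝ → ℝ, IsPeriodicSol S x → (∀ t ∈ Set.Icc (0:ℝ) 1, x t ∈ U) →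
      IsPeriodicSol S y → (∀ t ∈ Set.Icc (0:ℝ) 1, y t ∈ U) →
      ∀ t ∈ Set.Icc (0:ℝ) 1, x t = y t) ∧
    (∀ x : ℝ → ℝ, IsPeriodicSol S x → (∀ t ∈ Set.Icc (0:ℝ) 1, x t ∈ U) →
      0 < σ * ∫ t in (0:ℝ)..1, deriv (fun y => S y t) (x t)) := by
  have hSd : ∀ t p, HasDerivAt (fun z => S z t)
      (∑ i ∈ Finset.range (m + 1), a i t * (i * p ^ (i - 1))) p := by
    intro t p
    simp only [hS]
    exact HasDerivAt.fun_sum fun i _ => (hasDerivAt_pow i p).const_mul (a i t)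
  have hac : ∀ i ∈ Finset.range (m + 1), ContinuousOn (a i) (Icc 0 1) :=
    fun i hi => (ha i (Nat.lt_succ_iff.1 (Finset.mem_range.1 hi))).continuousOn
  have hSc : ∀ x : ℝ → ℝ, IsPeriodicSol S x → ContinuousOn (fun t => S (x t) t) (Icc 0 1) := by
    intro x hx
    simp only [hS]
    exact continuousOn_finsetSum _ fun i hi => (hac i hi).mul (hx.continuousOn.pow i)
  have hSc' : ∀ x : ℝ → ℝ, IsPeriodicSol S x →
      ContinuousOn (fun t => deriv (fun z => S z t) (x t)) (Icc 0 1) := by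
    intro x hx
    simp only [fun t p => (hSd t p).deriv]
    exact continuousOn_finsetSum _ fun i hi =>
      (hac i hi).mul (continuousOn_const.mul (hx.continuousOn.pow (i - 1)))
  obtain ⟨t₀, ht₀⟩ := hEne
  have hσ0 : σ ≠ 0 := by rcases hσ with rfl | rfl <;> norm_num
  have hpos : ∀ p ∈ U, 0 < σ * G p t₀ := fun p hp =>
    (hGsign p hp t₀ (hEsub ht₀)).lt_of_ne' (mul_ne_zero hσ0 (hGne p hp t₀ ht₀))
  simp only [hG] at hGsign hpos
  refine ⟨fun x y hx hxU hy hyU => ?_, fun x hx hxU => ?_⟩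
  · exact hx.eqOn hy hUopen hUconn hF hxU hyU (hSc x hx) (hSc y hy)
      (S' := fun p t => deriv (fun z => S z t) p)
      (fun t p _ => (hSd t p).differentiableAt.hasDerivAt) hGsign (hEsub ht₀) hpos
  · exact hx.integral_pos hUopen hUconn hF hxU (S' := fun p t => deriv (fun z => S z t) p)
      (hSc x hx) (hSc' x hx) (fun t ht => hGsign _ (hxU t ht) t ht)
      ⟨t₀, hEsub ht₀, hpos _ (hxU t₀ (hEsub ht₀))⟩
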